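/- In Z[x1,...,xn,y1,...,yn] with a monomial order in which every monomial containing more y-variables (counted with multiplicity) is greater than any monomial with fewer, the initial ideal of the kernel K_Q of π (sending xi to xi and yi to the adjacent cluster variable xi') is the squarefree monomial ideal generated by {x_i y_i : 1 ≤ i ≤ n} together with {y_{v_1} y_{v_2} ⋯ y_{v_k} : v_1→v_2→⋯→v_k→v_1 a vertex-minimal directed cycle of unfrozen vertices in Q}. -/

import Mathlib

open Sum

/-- The Laurent polynomial ring `ℤ[x₁^{±1},...,xₙ^{±1}]`. -/
abbrev MvLaurent (n : ℕ) : Type := AddMonoidAlgebra ℤ (Fin n →₀ ℤ)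

/-- The (invertible) variable `xᵢ` of the Laurent polynomial ring. -/
noncomputable def Xu {n : ℕ} (i : Fin n) : (MvLaurent n)ˣ :=
  Units.map (AddMonoidAlgebra.of ℤ (Fin n →₀ ℤ))
    (toUnits (Multiplicative.ofAdd (Finsupp.single i (1 : ℤ))))

/-- An ice quiver on `n` vertices. -/
structure IceQuiver (n : ℕ) where
  arrows : Fin n → Fin n → ℕ
  frozen : Fin n → Bool
  no_loops : ∀ i, arrows i i = 0
  no_two_cycles : ∀ i j, arrows i j = 0 ∨ arrows j i = 0

/-- `pᵢ⁺`, the product of `x_{target(a)}` over arrows `a` with source `i`. -/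
noncomputable def Pp {n : ℕ} (Q : IceQuiver n) (i : Fin n) : (MvLaurent n)ˣ :=
  ∏ j, (Xu j) ^ (Q.arrows i j)

/-- `pᵢ⁻`, the product of `x_{source(a)}` over arrows `a` with target `i`. -/
noncomputable def Pm {n : ℕ} (Q : IceQuiver n) (i : Fin n) : (MvLaurent n)ˣ :=
  ∏ j, (Xu j) ^ (Q.arrows j i)

/-- The adjacent cluster variable `xᵢ'`: `xᵢ⁻¹(pᵢ⁺ + pᵢ⁻)` for `i` unfrozen, `xᵢ⁻¹`
for `i` frozen. -/
noncomputable def adjVar {n : ℕ} (Q : IceQuiver n) (i : Fin n) : MvLaurent n :=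
  if Q.frozen i then (((Xu i)⁻¹ : (MvLaurent n)ˣ) : MvLaurent n)
  else (((Xu i)⁻¹ : (MvLaurent n)ˣ) : MvLaurent n) *
    ((Pp Q i : MvLaurent n) + (Pm Q i : MvLaurent n))

/-- The homomorphism `π : ℤ[x₁,...,xₙ,y₁,...,yₙ] → ℤ[x₁^{±1},...,xₙ^{±1}]` with
`π(xᵢ) = xᵢ` and `π(yᵢ) = xᵢ'`; variables indexed by `Fin n ⊕ Fin n`
(`inl i = xᵢ`, `inr i = yᵢ`). -/
noncomputable def piHom {n : ℕ} (Q : IceQuiver n) :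
    MvPolynomial (Fin n ⊕ Fin n) ℤ →+* MvLaurent n :=
  (MvPolynomial.aeval
    (Sum.elim (fun i => ((Xu i : (MvLaurent n)ˣ) : MvLaurent n)) (adjVar Q))).toRingHom

/-- `a :: l` is a directed cycle of unfrozen vertices in `Q`: there is an arrow from
each entry to the next, an arrow from the last entry back to `a`, and every entry is
unfrozen. -/
def IsCycle {n : ℕ} (Q : IceQuiver n) (a : Fin n) (l : List (Fin n)) : Prop :=
  List.Chain (fun u v => 0 < Q.arrows u v) a (l ++ [a]) ∧
    ∀ u ∈ a :: l, Q.frozen u = false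

/-- `T` is the vertex set of a vertex-minimal directed cycle of unfrozen vertices:
`T` is the vertex set of a directed cycle with no repeated vertices, and no directed
cycle of unfrozen vertices has vertex set a proper subset of `T`. -/
def IsVertexMinimalCycle {n : ℕ} (Q : IceQuiver n) (T : Finset (Fin n)) : Prop :=
  (∃ a l, IsCycle Q a l ∧ (a :: l).Nodup ∧ (a :: l).toFinset = T) ∧
    ∀ T' : Finset (Fin n), (∃ a l, IsCycle Q a l ∧ (a :: l).toFinset = T') → ¬T' ⊂ T

/-- The `y`-degree of a monomial: the total multiplicity of `y`-variables in it. -/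
def ydeg {n : ℕ} (m : (Fin n ⊕ Fin n) →₀ ℕ) : ℕ := ∑ i : Fin n, m (inr i)

/-- The initial ideal of `I` with respect to the order `lt` on monomials: the ideal
generated by the leading monomials of the nonzero elements of `I`. -/
noncomputable def initialIdeal {n : ℕ} (lt : ((Fin n ⊕ Fin n) →₀ ℕ) → ((Fin n ⊕ Fin n) →₀ ℕ) → Prop)
    (I : Ideal (MvPolynomial (Fin n ⊕ Fin n) ℤ)) : Ideal (MvPolynomial (Fin n ⊕ Fin n) ℤ) :=
  Ideal.span {g | ∃ f ∈ I, ∃ m ∈ f.support,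
    (∀ m' ∈ f.support, m' ≠ m → lt m' m) ∧ g = MvPolynomial.monomial m (1 : ℤ)}

namespace LB
open MvPolynomial

lemma ydeg_add {n : ℕ} (a b : (Fin n ⊕ Fin n) →₀ ℕ) : ydeg (a + b) = ydeg a + ydeg b := by
  simp [ydeg, Finset.sum_add_distrib]

/-- images of polynomials of y-degree less than k -/
def L {n : ℕ} (Q : IceQuiver n) (k : ℕ) (z : MvLaurent n) : Prop :=
  ∃ h : MvPolynomial (Fin n ⊕ Fin n) ℤ, (∀ m ∈ h.support, ydeg m < k) ∧ piHom Q h = z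

variable {n : ℕ} {Q : IceQuiver n}

lemma L.zero {k} : L Q k 0 := ⟨0, by simp, by simp⟩

lemma L.mono {j k z} (h : L Q j z) (hjk : j ≤ k) : L Q k z := by
  obtain ⟨p, hp, rfl⟩ := h
  exact ⟨p, fun m hm => (hp m hm).trans_le hjk, rfl⟩

lemma L.add {k z z'} (h : L Q k z) (h' : L Q k z') : L Q k (z + z') := by
  classical
  obtain ⟨p, hp, rfl⟩ := h
  obtain ⟨p', hp', rfl⟩ := h'
  refine ⟨p + p', fun m hm => ?_, by simp⟩
  rcases Finset.mem_union.1 (support_add hm) with h | h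
  · exact hp m h
  · exact hp' m h

lemma L.neg {k z} (h : L Q k z) : L Q k (-z) := by
  obtain ⟨p, hp, rfl⟩ := h
  exact ⟨-p, fun m hm => hp m (by simpa using hm), by simp⟩

lemma L.sub {k z z'} (h : L Q k z) (h' : L Q k z') : L Q k (z - z') := by
  rw [sub_eq_add_neg]; exact h.add h'.neg

lemma L.mul {a b z z'} (h : L Q (a + 1) z) (h' : L Q b z') : L Q (a + b) (z * z') := by
  classical
  obtain ⟨p, hp, rfl⟩ := h
  obtain ⟨p', hp', rfl⟩ := h'
  refine ⟨p * p', fun m hm => ?_, by simp⟩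
  obtain ⟨u, hu, v, hv, rfl⟩ := Finset.mem_add.1 (support_mul _ _ hm)
  have := hp u hu
  have := hp' v hv
  rw [ydeg_add]; omega

lemma L.mul1 {b z z'} (h : L Q 1 z) (h' : L Q b z') : L Q b (z * z') := by
  simpa using L.mul (a := 0) h h'

lemma ydeg_single_inl (i : Fin n) (k : ℕ) : ydeg (Finsupp.single (Sum.inl i : Fin n ⊕ Fin n) k) = 0 := by
  simp [ydeg]

lemma ydeg_single_inr (i : Fin n) (k : ℕ) : ydeg (Finsupp.single (Sum.inr i : Fin n ⊕ Fin n) k) = k := by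
  classical
  simp [ydeg, Finsupp.single_apply]

lemma L.one : L Q 1 1 := by
  refine ⟨1, fun m hm => ?_, by simp⟩
  have : m = 0 := by
    by_contra h
    rw [mem_support_iff, MvPolynomial.coeff_one, if_neg (Ne.symm h)] at hm
    exact hm rfl
  subst this
  simp [ydeg]

lemma pi_inl (i : Fin n) : piHom Q (X (inl i)) = (Xu i : MvLaurent n) := by simp [piHom]
lemma pi_inr (i : Fin n) : piHom Q (X (inr i)) = adjVar Q i := by simp [piHom]

lemma L.x (i : Fin n) : L Q 1 (Xu i : MvLaurent n) := by
  refine ⟨X (inl i), fun m hm => ?_, pi_inl i⟩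
  rw [support_X, Finset.mem_singleton] at hm
  subst hm
  rw [ydeg_single_inl]; norm_num

lemma L.y (i : Fin n) : L Q 2 (adjVar Q i) := by
  refine ⟨X (inr i), fun m hm => ?_, pi_inr i⟩
  rw [support_X, Finset.mem_singleton] at hm
  subst hm
  rw [ydeg_single_inr]; norm_num

lemma L.pow {z} (h : L Q 1 z) (k : ℕ) : L Q 1 (z ^ k) := by
  induction k with
  | zero => simpa using L.one
  | succ k ih => rw [pow_succ]; exact ih.mul1 h

lemma L.prod {s : Finset (Fin n)} {f : Fin n → ℕ} :
    L Q 1 ((∏ j ∈ s, Xu j ^ f j : (MvLaurent n)ˣ) : MvLaurent n) := by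
  rw [Units.coe_prod]
  refine Finset.prod_induction _ (L Q 1) (fun _ _ => L.mul1) L.one fun j _ => ?_
  rw [Units.val_pow_eq_pow_val]
  exact (L.x j).pow _

lemma L.factor {f : Fin n → ℕ} {w : Fin n} (h : 0 < f w) : ∃ c : (MvLaurent n)ˣ,
    L Q 1 (c : MvLaurent n) ∧ ∏ j, Xu j ^ f j = Xu w * c := by
  classical
  refine ⟨Xu w ^ (f w - 1) * ∏ j ∈ Finset.univ.erase w, Xu j ^ f j, ?_, ?_⟩
  · rw [Units.val_mul, Units.val_pow_eq_pow_val]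
    exact ((L.x w).pow _).mul1 L.prod
  · rw [← mul_assoc, mul_pow_sub_one h.ne']
    exact (Finset.mul_prod_erase Finset.univ (fun j => Xu j ^ f j) (Finset.mem_univ w)).symm

lemma L.fp {v w : Fin n} (h : 0 < Q.arrows v w) : ∃ c : (MvLaurent n)ˣ,
    L Q 1 (c : MvLaurent n) ∧ Pp Q v = Xu w * c := L.factor (f := fun j => Q.arrows v j) h

lemma L.fm {u v : Fin n} (h : 0 < Q.arrows u v) : ∃ c : (MvLaurent n)ˣ,
    L Q 1 (c : MvLaurent n) ∧ Pm Q v = Xu u * c := L.factor (f := fun j => Q.arrows j v) h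

variable (Q) in
noncomputable def ua (v : Fin n) : (MvLaurent n)ˣ := (Xu v)⁻¹ * Pp Q v
variable (Q) in
noncomputable def ub (v : Fin n) : (MvLaurent n)ˣ := (Xu v)⁻¹ * Pm Q v

lemma adj_eq {v : Fin n} (h : Q.frozen v = false) :
    adjVar Q v = (ua Q v : MvLaurent n) + (ub Q v : MvLaurent n) := by
  simp [adjVar, h, ua, ub, mul_add]

lemma ab {v w : Fin n} (h : 0 < Q.arrows v w) : L Q 1 ((ua Q v * ub Q w : (MvLaurent n)ˣ) : MvLaurent n) := by
  obtain ⟨c, hc, h1⟩ := L.fp h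
  obtain ⟨d, hd, h2⟩ := L.fm h
  have : ua Q v * ub Q w = c * d := by
    have e : (Xu v)⁻¹ * (Xu w * c) * ((Xu w)⁻¹ * (Xu v * d))
      = ((Xu v)⁻¹ * Xu v) * (((Xu w)⁻¹ * Xu w) * (c * d)) := by
      simp only [mul_assoc, mul_comm, mul_left_comm]
    rw [ua, ub, h1, h2, e, inv_mul_cancel, inv_mul_cancel, one_mul, one_mul]
  rw [this, Units.val_mul]
  exact hc.mul1 hd

variable (Q) in
noncomputable def AA (l : List (Fin n)) : (MvLaurent n)ˣ := (l.map (ua Q)).prod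
variable (Q) in
noncomputable def BB (l : List (Fin n)) : (MvLaurent n)ˣ := (l.map (ub Q)).prod
variable (Q) in
noncomputable def SS : List (Fin n) → MvLaurent n
  | [] => 1
  | v :: l => (AA Q (v :: l) : MvLaurent n) + (ub Q v : MvLaurent n) * SS l
variable (Q) in
noncomputable def YY (l : List (Fin n)) : MvLaurent n := (l.map (adjVar Q)).prod

lemma YY_L : ∀ l : List (Fin n), L Q (l.length + 1) (YY Q l)
  | [] => L.one
  | v :: l => by
    have := (L.y (Q := Q) v).mul (a := 1) (YY_L l)
    simpa [YY, add_comm, add_left_comm] using this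

lemma path : ∀ l : List (Fin n), l.IsChain (fun u v => 0 < Q.arrows u v) →
    (∀ u ∈ l, Q.frozen u = false) → L Q l.length (YY Q l - SS Q l)
  | [], _, _ => by simpa [YY, SS] using L.zero
  | [v], _, hf => by
    have : YY Q [v] - SS Q [v] = 0 := by
      simp [YY, SS, AA, adj_eq (hf v (by simp))]
    rw [this]; exact L.zero
  | v :: w :: l, hc, hf => by
    rw [List.isChain_cons_cons] at hc
    have h1 := path (w :: l) hc.2 (fun u hu => hf u (List.mem_cons_of_mem _ hu))
    have h2 := path l (List.isChain_of_isChain_cons hc.2)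
      (fun u hu => hf u (List.mem_cons_of_mem _ (List.mem_cons_of_mem _ hu)))
    have h3 : L Q (l.length + 1) (SS Q l) := by
      have := (YY_L (Q := Q) l).sub (h2.mono (Nat.le_succ _))
      simpa using this
    have h4 := (L.y (Q := Q) v).mul (a := 1) h1
    have h5 := (ab hc.1).mul1 h3
    have : YY Q (v :: w :: l) - SS Q (v :: w :: l) =
        adjVar Q v * (YY Q (w :: l) - SS Q (w :: l)) +
        ((ua Q v * ub Q w : (MvLaurent n)ˣ) : MvLaurent n) * SS Q l := by
      have e1 : YY Q (v :: w :: l) = adjVar Q v * YY Q (w :: l) := by simp [YY]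
      have e2 : AA Q (v :: w :: l) = ua Q v * AA Q (w :: l) := by simp [AA]
      rw [e1, SS, SS, e2, adj_eq (hf v (by simp))]
      push_cast
      ring
    rw [this]
    refine L.add (h4.mono ?_) (h5.mono ?_) <;> simp; omega

lemma SS_append : ∀ (m : List (Fin n)) (u : Fin n),
    SS Q (m ++ [u]) = SS Q m * (ua Q u : MvLaurent n) + (BB Q (m ++ [u]) : MvLaurent n)
  | [], u => by simp [SS, AA, BB]
  | v :: m, u => by
    have e1 : AA Q (v :: (m ++ [u])) = AA Q (v :: m) * ua Q u := by simp [AA, mul_assoc]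
    have e2 : BB Q (v :: (m ++ [u])) = ub Q v * BB Q (m ++ [u]) := by simp [BB]
    rw [List.cons_append, SS, SS_append m u, SS, e1, e2]
    push_cast
    ring

lemma AA_L : ∀ (l : List (Fin n)) (v w : Fin n),
    (v :: (l ++ [w])).IsChain (fun u v => 0 < Q.arrows u v) →
    ∃ c : (MvLaurent n)ˣ, L Q 1 (c : MvLaurent n) ∧ AA Q (v :: l) = (Xu v)⁻¹ * (Xu w * c)
  | [], v, w, h => by
    obtain ⟨c, hc, h1⟩ := L.fp (Q := Q) (v := v) (w := w) (by simpa using h)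
    exact ⟨c, hc, by simp [AA, ua, h1]⟩
  | v' :: l, v, w, h => by
    rw [List.cons_append, List.isChain_cons_cons] at h
    obtain ⟨c, hc, h1⟩ := L.fp h.1
    obtain ⟨d, hd, h2⟩ := AA_L l v' w h.2
    refine ⟨c * d, by rw [Units.val_mul]; exact hc.mul1 hd, ?_⟩
    have e2 : AA Q (v :: v' :: l) = ua Q v * AA Q (v' :: l) := by simp [AA]
    rw [e2, h2, ua, h1]
    have : Xu v' * c * ((Xu v')⁻¹ * (Xu w * d)) = Xu w * (c * d) := by
      rw [mul_mul_mul_comm, mul_inv_cancel, one_mul, mul_left_comm]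
    rw [mul_assoc, this]

lemma BB_L : ∀ (l : List (Fin n)) (u w : Fin n),
    (u :: (l ++ [w])).IsChain (fun u v => 0 < Q.arrows u v) →
    ∃ c : (MvLaurent n)ˣ, L Q 1 (c : MvLaurent n) ∧ BB Q (l ++ [w]) = (Xu w)⁻¹ * (Xu u * c)
  | [], v, w, h => by
    obtain ⟨c, hc, h1⟩ := L.fm (Q := Q) (u := v) (v := w) (by simpa using h)
    exact ⟨c, hc, by simp [BB, ub, h1]⟩
  | v' :: l, v, w, h => by
    rw [List.cons_append, List.isChain_cons_cons] at h
    obtain ⟨c, hc, h1⟩ := L.fm h.1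
    obtain ⟨d, hd, h2⟩ := BB_L l v' w h.2
    refine ⟨c * d, by rw [Units.val_mul]; exact hc.mul1 hd, ?_⟩
    have e2 : BB Q (v' :: (l ++ [w])) = ub Q v' * BB Q (l ++ [w]) := by simp [BB]
    rw [List.cons_append, e2, h2, ub, h1]
    have : (Xu v')⁻¹ * (Xu v * c) * ((Xu w)⁻¹ * (Xu v' * d))
      = ((Xu v')⁻¹ * Xu v') * ((Xu w)⁻¹ * (Xu v * (c * d))) := by
      simp only [mul_assoc, mul_comm, mul_left_comm]
    rw [this, inv_mul_cancel, one_mul]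

lemma cycle_L {a : Fin n} {l : List (Fin n)} (h : IsCycle Q a l) :
    L Q (a :: l).length (YY Q (a :: l)) := by
  obtain ⟨hc, hf⟩ := h
  change List.IsChain _ (a :: (l ++ [a])) at hc
  rcases List.eq_nil_or_concat' l with rfl | ⟨m, u, rfl⟩
  · simp [Q.no_loops] at hc
  obtain ⟨c, hc1, hA⟩ := AA_L _ _ _ hc
  obtain ⟨d, hd1, hB⟩ := BB_L _ _ _ hc
  have hB' : BB Q (m ++ [u] ++ [a]) = ub Q a * BB Q (m ++ [u]) := by
    simp [BB, mul_assoc, mul_comm]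
  rw [hB', inv_mul_cancel_left] at hB
  rw [inv_mul_cancel_left] at hA
  have hc' : List.IsChain (fun u v => 0 < Q.arrows u v) (a :: (m ++ [u])) := by
    have := List.IsChain.left_of_append (l₁ := a :: (m ++ [u])) (l₂ := [a]) (by simpa using hc)
    exact this
  have hm : List.IsChain (fun u v => 0 < Q.arrows u v) m :=
    List.IsChain.left_of_append (List.isChain_of_isChain_cons hc')
  have hua : 0 < Q.arrows u a := by
    have := List.IsChain.right_of_append (l₁ := a :: m) (l₂ := [u, a]) (by simpa using hc)
    simpa using this
  have h1 := path _ hc' hf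
  have h2 := path _ hm (fun v hv => hf v (by simp [hv]))
  have h3 : L Q (m.length + 1) (SS Q m) := by
    have := (YY_L (Q := Q) m).sub (h2.mono (Nat.le_succ _))
    simpa using this
  have h5 := (ab hua).mul1 h3
  have e : YY Q (a :: (m ++ [u])) = (YY Q (a :: (m ++ [u])) - SS Q (a :: (m ++ [u]))) +
      ((ua Q u * ub Q a : (MvLaurent n)ˣ) : MvLaurent n) * SS Q m
      + (AA Q (a :: (m ++ [u])) : MvLaurent n)
      + ((ub Q a * BB Q (m ++ [u]) : (MvLaurent n)ˣ) : MvLaurent n) := by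
    rw [SS, SS_append]
    push_cast
    ring
  rw [e, hA, hB]
  refine ((h1.add (h5.mono ?_)).add (hc1.mono ?_)).add (hd1.mono ?_) <;> simp

lemma mem_init (lt : ((Fin n ⊕ Fin n) →₀ ℕ) → ((Fin n ⊕ Fin n) →₀ ℕ) → Prop)
    (hy : ∀ a b, ydeg a < ydeg b → lt a b) (m : (Fin n ⊕ Fin n) →₀ ℕ)
    (h : L Q (ydeg m) (piHom Q (monomial m 1))) :
    monomial m (1 : ℤ) ∈ initialIdeal lt (RingHom.ker (piHom Q)) := by
  classical
  obtain ⟨p, hp, he⟩ := h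
  have hpm : coeff m p = 0 := by
    by_contra hne
    exact lt_irrefl _ (hp m (mem_support_iff.2 hne))
  refine Ideal.subset_span ⟨monomial m 1 - p, ?_, m, ?_, ?_, rfl⟩
  · rw [RingHom.mem_ker, map_sub, he, sub_self]
  · simp [mem_support_iff, hpm]
  · intro m' hm' hne
    apply hy
    apply hp
    rw [mem_support_iff, coeff_sub, coeff_monomial, if_neg (Ne.symm hne), zero_sub] at hm'
    rw [mem_support_iff]
    intro h0
    exact hm' (by rw [h0, neg_zero])

lemma xy_L (i : Fin n) : L Q 1 (Xu i * adjVar Q i : MvLaurent n) := by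
  by_cases h : Q.frozen i
  · simpa [adjVar, h] using L.one
  · have : (Xu i * adjVar Q i : MvLaurent n) = (Pp Q i : MvLaurent n) + (Pm Q i : MvLaurent n) := by
      simp [adjVar, h]
    rw [this]
    exact L.prod.add L.prod

lemma supset (lt : ((Fin n ⊕ Fin n) →₀ ℕ) → ((Fin n ⊕ Fin n) →₀ ℕ) → Prop)
    (hy : ∀ a b, ydeg a < ydeg b → lt a b) :
      Ideal.span
        ({g | ∃ i : Fin n, g = X (inl i) * X (inr i)} ∪
          {g | ∃ T : Finset (Fin n), IsVertexMinimalCycle Q T ∧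
            g = ∏ i ∈ T, X (inr i)}) ≤ initialIdeal lt (RingHom.ker (piHom Q)) := by
  classical
  rw [Ideal.span_le]
  rintro g (⟨i, rfl⟩ | ⟨T, ⟨⟨a, l, hc, hn, rfl⟩, -⟩, rfl⟩)
  · have e : (X (inl i) * X (inr i) : MvPolynomial (Fin n ⊕ Fin n) ℤ) =
      monomial (Finsupp.single (inl i) 1 + Finsupp.single (inr i) 1) 1 := by
      simp [X, monomial_mul]
    rw [e]
    apply mem_init lt hy
    rw [← e, ydeg_add, ydeg_single_inl, ydeg_single_inr, map_mul, pi_inl, pi_inr]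
    exact xy_L i
  · have e : (∏ i ∈ (a :: l).toFinset, X (inr i) : MvPolynomial (Fin n ⊕ Fin n) ℤ) =
      monomial (∑ i ∈ (a :: l).toFinset, Finsupp.single (inr i) 1) 1 := by
      rw [monomial_sum_one]; rfl
    rw [e]
    apply mem_init lt hy
    have hd : ydeg (∑ i ∈ (a :: l).toFinset, Finsupp.single (inr i : Fin n ⊕ Fin n) 1)
        = (a :: l).length := by
      rw [← List.toFinset_card_of_nodup hn]
      simp only [ydeg, Finsupp.finsetSum_apply]
      rw [Finset.sum_comm, Finset.card_eq_sum_ones]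
      refine Finset.sum_congr rfl fun i _ => ?_
      exact ydeg_single_inr i 1
    rw [hd, ← e, map_prod]
    simp only [pi_inr]
    rw [List.prod_toFinset _ hn]
    exact cycle_L hc

lemma dup_split : ∀ l : List (Fin n), ¬ l.Nodup → ∃ p x q s, l = p ++ ((x :: q) ++ (x :: s))
  | [], h => (h List.nodup_nil).elim
  | a :: l, h => by
    by_cases ha : a ∈ l
    · obtain ⟨q, s, rfl⟩ := List.append_of_mem ha
      exact ⟨[], a, q, s, by simp⟩
    · have : ¬ l.Nodup := fun hl => h (List.nodup_cons.2 ⟨ha, hl⟩)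
      obtain ⟨p, x, q, s, rfl⟩ := dup_split l this
      exact ⟨a :: p, x, q, s, by simp⟩

lemma nodup_cycle : ∀ (k : ℕ) (a : Fin n) (l : List (Fin n)), l.length = k → IsCycle Q a l →
    ∃ a' l', IsCycle Q a' l' ∧ (a' :: l').Nodup ∧ ∀ u ∈ a' :: l', u ∈ a :: l := by
  intro k
  induction k using Nat.strong_induction_on with
  | _ k ih =>
    intro a l hk hc
    by_cases hn : (a :: l).Nodup
    · exact ⟨a, l, hc, hn, fun u hu => hu⟩
    obtain ⟨p, x, q, s, he⟩ := dup_split _ hn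
    have hc1 : List.IsChain (fun u v => 0 < Q.arrows u v) (a :: (l ++ [a])) := hc.1
    have hx : IsCycle Q x q := by
      constructor
      · change List.IsChain _ (x :: (q ++ [x]))
        refine hc1.infix ⟨p, s ++ [a], ?_⟩
        simpa using (congrArg (· ++ [a]) he).symm
      · intro u hu
        apply hc.2
        rw [he]
        exact List.mem_append_right _ (List.mem_append_left _ hu)
    have hlen : q.length < k := by
      have := congrArg List.length he
      simp at this
      omega
    obtain ⟨a', l', h1, h2, h3⟩ := ih _ hlen x q rfl hx
    refine ⟨a', l', h1, h2, fun u hu => ?_⟩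
    rw [he]
    exact List.mem_append_right _ (List.mem_append_left _ (h3 u hu))

lemma exists_minimal (B : Finset (Fin n)) (h : ∃ a l, IsCycle Q a l ∧ ∀ u ∈ a :: l, u ∈ B) :
    ∃ T, IsVertexMinimalCycle Q T ∧ T ⊆ B := by
  classical
  let S : Set (Fin n × List (Fin n)) := {x | IsCycle Q x.1 x.2 ∧ (x.1 :: x.2).Nodup ∧
    ∀ u ∈ x.1 :: x.2, u ∈ B}
  have hS : S.Nonempty := by
    obtain ⟨a, l, hc, hB⟩ := h
    obtain ⟨a', l', h1, h2, h3⟩ := nodup_cycle _ a l rfl hc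
    exact ⟨(a', l'), h1, h2, fun u hu => hB u (h3 u hu)⟩
  obtain ⟨⟨a, l⟩, ⟨hc, hn, hB⟩, hmin⟩ := (measure fun x : Fin n × List (Fin n) =>
    x.2.length).wf.has_min S hS
  refine ⟨(a :: l).toFinset, ⟨⟨a, l, hc, hn, rfl⟩, ?_⟩, fun u hu => hB u (List.mem_toFinset.1 hu)⟩
  rintro T' ⟨a1, l1, hc1, rfl⟩ hss
  obtain ⟨a', l', h1, h2, h3⟩ := nodup_cycle _ a1 l1 rfl hc1
  have hsub : (a' :: l').toFinset ⊆ (a1 :: l1).toFinset := fun u hu =>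
    List.mem_toFinset.2 (h3 u (List.mem_toFinset.1 hu))
  have hlt := Finset.card_lt_card (hsub.trans_ssubset hss)
  rw [List.toFinset_card_of_nodup h2, List.toFinset_card_of_nodup hn] at hlt
  refine hmin (a', l') ⟨h1, h2, fun u hu => hB u (List.mem_toFinset.1
    (hss.1 (hsub (List.mem_toFinset.2 hu))))⟩ ?_
  change l'.length < l.length
  simpa using hlt

variable (Q) in
/-- exponents of the two products, trivial at frozen vertices -/
def ex (s : Bool) (i j : Fin n) : ℕ :=
  if Q.frozen i then 0 else if s then Q.arrows i j else Q.arrows j i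

lemma wf_of_acyclic (B : Finset (Fin n)) (h : ¬ ∃ a l, IsCycle Q a l ∧ ∀ u ∈ a :: l, u ∈ B) :
    WellFounded fun j i => 0 < Q.arrows j i ∧ Q.frozen i = false ∧ i ∈ B := by
  set r : Fin n → Fin n → Prop := fun j i => 0 < Q.arrows j i ∧ Q.frozen i = false ∧ i ∈ B with hr
  have hirr : ∀ a, ¬ Relation.TransGen r a a := by
    intro a ha
    apply h
    obtain ⟨b, hab, hba⟩ := Relation.TransGen.tail'_iff.1 ha
    obtain ⟨l, hl, hlast⟩ := List.exists_isChain_cons_of_relationReflTransGen hab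
    have hch : List.IsChain r (a :: (l ++ [a])) := by
      rw [← List.cons_append, List.isChain_append]
      refine ⟨hl, by simp, ?_⟩
      intro x hx y hy
      rw [List.getLast?_eq_getLast_of_ne_nil (List.cons_ne_nil _ _), hlast] at hx
      simp at hx hy
      subst hx hy
      exact hba
    have key : ∀ (t : List (Fin n)) (x : Fin n), List.IsChain r (x :: t) →
        ∀ u ∈ t, Q.frozen u = false ∧ u ∈ B := by
      intro t
      induction t with
      | nil => simp
      | cons y t ih =>
        intro x hx u hu
        rw [List.isChain_cons_cons] at hx
        rcases List.mem_cons.1 hu with rfl | hu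
        · exact hx.1.2
        · exact ih y hx.2 u hu
    have key2 : ∀ u ∈ a :: l, Q.frozen u = false ∧ u ∈ B := by
      intro u hu
      apply key _ _ hch
      rcases List.mem_cons.1 hu with rfl | hu <;> simp [*]
    exact ⟨a, l, ⟨hch.imp (fun _ _ h => h.1), fun u hu => (key2 u hu).1⟩, fun u hu => (key2 u hu).2⟩
  have : IsTrans (Fin n) (Relation.TransGen r) := ⟨fun _ _ _ => Relation.TransGen.trans⟩
  have : Std.Irrefl (Relation.TransGen r) := ⟨hirr⟩
  exact Subrelation.wf (fun h => Relation.TransGen.single h)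
    (Finite.wellFounded_of_trans_of_irrefl (Relation.TransGen r))

lemma exists_weight (B : Finset (Fin n)) (h : ¬ ∃ a l, IsCycle Q a l ∧ ∀ u ∈ a :: l, u ∈ B) :
    ∃ w : Fin n → ℕ, ∀ i, w i = if i ∈ B then
      1 + min (∑ j, w j * ex Q true i j) (∑ j, w j * ex Q false i j) else 0 := by
  classical
  have hwf := wf_of_acyclic B h
  let F : (Fin n → ℕ) → Fin n → ℕ := fun w i => if i ∈ B then
      1 + min (∑ j, w j * ex Q true i j) (∑ j, w j * ex Q false i j) else 0
  have hmono : ∀ w w', (∀ i, w i ≤ w' i) → ∀ i, F w i ≤ F w' i := by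
    intro w w' hw i
    simp only [F]
    split_ifs
    · refine Nat.add_le_add_left (min_le_min ?_ ?_) 1 <;>
      exact Finset.sum_le_sum fun j _ => Nat.mul_le_mul_right _ (hw j)
    · exact le_rfl
  let S : Set (Fin n → ℕ) := {w | ∀ i, F w i ≤ w i}
  have hS : S.Nonempty := by
    let u : Fin n → ℕ := hwf.fix fun i rec => if i ∈ B then
      1 + ∑ j, (if hj : 0 < Q.arrows j i ∧ Q.frozen i = false ∧ i ∈ B then
        rec j hj * Q.arrows j i else 0) else 0
    have hu : ∀ i, u i = if i ∈ B then
      1 + ∑ j, (if hj : 0 < Q.arrows j i ∧ Q.frozen i = false ∧ i ∈ B then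
        u j * Q.arrows j i else 0) else 0 := fun i => hwf.fix_eq _ i
    refine ⟨u, fun i => ?_⟩
    simp only [F]
    rw [hu i]
    split_ifs with hi
    · refine Nat.add_le_add_left ((min_le_right _ _).trans ?_) 1
      refine Finset.sum_le_sum fun j _ => ?_
      split_ifs with hj
      · simp [ex, hj.2.1]
      · unfold ex
        cases hfi : Q.frozen i
        · have : Q.arrows j i = 0 := by
            by_contra h0
            exact hj ⟨Nat.pos_of_ne_zero h0, hfi, hi⟩
          simp [this]
        · simp
    · exact le_rfl
  obtain ⟨w, hw, hmin⟩ := (measure fun w : Fin n → ℕ => ∑ i, w i).wf.has_min S hS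
  refine ⟨w, fun i => ?_⟩
  have h1 : F w ∈ S := fun i => hmono _ _ hw i
  have h2 : ∑ i, w i ≤ ∑ i, F w i := not_lt.1 (hmin _ h1)
  have h3 := (Finset.sum_eq_sum_iff_of_le (fun i _ => hw i)).1
    (le_antisymm (Finset.sum_le_sum fun i _ => hw i) h2)
  exact (h3 i (Finset.mem_univ i)).symm

section top
variable {Γ : Type*} [AddCommGroup Γ] [LinearOrder Γ] [IsOrderedAddMonoid Γ]

def HasTop (D : (Fin n →₀ ℤ) →+ Γ) (h : MvLaurent n) (e : Fin n →₀ ℤ) : Prop :=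
  h.coeff e ≠ 0 ∧ ∀ e', h.coeff e' ≠ 0 → e' ≠ e → D e' < D e

variable {D : (Fin n →₀ ℤ) →+ Γ}

lemma HasTop.le {h e e'} (H : HasTop D h e) (he : h.coeff e' ≠ 0) : D e' ≤ D e := by
  by_cases h' : e' = e
  · rw [h']
  · exact (H.2 _ he h').le

lemma HasTop.mul {f g : MvLaurent n} {a b} (hf : HasTop D f a) (hg : HasTop D g b) :
    HasTop D (f * g) (a + b) := by
  classical
  have key : ∀ a' b', f.coeff a' ≠ 0 → g.coeff b' ≠ 0 → (a' = a ∧ b' = b) ∨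
      D (a' + b') < D (a + b) := by
    intro a' b' ha hb
    rw [map_add, map_add]
    by_cases h1 : a' = a
    · by_cases h2 : b' = b
      · exact Or.inl ⟨h1, h2⟩
      · exact Or.inr (add_lt_add_of_le_of_lt (hf.le ha) (hg.2 _ hb h2))
    · exact Or.inr (add_lt_add_of_lt_of_le (hf.2 _ ha h1) (hg.le hb))
  constructor
  · rw [AddMonoidAlgebra.coeff_mul_add_of_uniqueAdd]
    · exact mul_ne_zero hf.1 hg.1
    · intro a' b' ha hb he
      rcases key a' b' (Finsupp.mem_support_iff.1 ha) (Finsupp.mem_support_iff.1 hb) with h | h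
      · exact h
      · rw [he] at h; exact (lt_irrefl _ h).elim
  · intro e he hne
    obtain ⟨a', ha, b', hb, rfl⟩ := Finset.mem_add.1
      (AddMonoidAlgebra.support_coeff_mul_subset f g (Finsupp.mem_support_iff.2 he))
    rcases key a' b' (Finsupp.mem_support_iff.1 ha) (Finsupp.mem_support_iff.1 hb) with h | h
    · exact (hne (by rw [h.1, h.2])).elim
    · exact h

lemma hasTop_single (e : Fin n →₀ ℤ) : HasTop D (AddMonoidAlgebra.single e 1) e := by
  classical
  constructor
  · simp
  · intro e' he hne
    simp [Finsupp.single_apply, hne.symm] at he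

lemma HasTop.pow {f : MvLaurent n} {a} (hf : HasTop D f a) (k : ℕ) : HasTop D (f ^ k) (k • a) := by
  induction k with
  | zero => simpa [AddMonoidAlgebra.one_def] using hasTop_single (D := D) 0
  | succ k ih => rw [pow_succ, succ_nsmul]; exact ih.mul hf

lemma HasTop.prod {ι : Type*} (s : Finset ι) {f : ι → MvLaurent n} {a : ι → Fin n →₀ ℤ}
    (h : ∀ i, HasTop D (f i) (a i)) : HasTop D (∏ i ∈ s, f i) (∑ i ∈ s, a i) := by
  classical
  induction s using Finset.induction_on with
  | empty => simpa [AddMonoidAlgebra.one_def] using hasTop_single (D := D) 0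
  | insert i s hi ih => rw [Finset.prod_insert hi, Finset.sum_insert hi]; exact (h i).mul ih

lemma Xu_val (i : Fin n) : (Xu i : MvLaurent n) = AddMonoidAlgebra.single (Finsupp.single i 1) 1 :=
  rfl

lemma Xu_inv_val (i : Fin n) : (((Xu i)⁻¹ : (MvLaurent n)ˣ) : MvLaurent n) =
    AddMonoidAlgebra.single (-Finsupp.single i 1) 1 := rfl

variable (Q) in
noncomputable def exv (s : Bool) (i : Fin n) : Fin n →₀ ℤ := ∑ j, Finsupp.single j (ex Q s i j : ℤ)

lemma exv_apply (s : Bool) (i j : Fin n) : exv Q s i j = ex Q s i j := by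
  classical
  simp [exv, Finsupp.finsetSum_apply, Finsupp.single_apply]

lemma prod_single (f : Fin n → ℕ) : ((∏ j, Xu j ^ f j : (MvLaurent n)ˣ) : MvLaurent n) =
    AddMonoidAlgebra.single (∑ j, Finsupp.single j (f j : ℤ)) 1 := by
  classical
  rw [Units.coe_prod]
  generalize (Finset.univ : Finset (Fin n)) = s
  induction s using Finset.induction_on with
  | empty => simp [AddMonoidAlgebra.one_def]
  | insert i s hi ih =>
    rw [Finset.prod_insert hi, Finset.sum_insert hi, ih, Units.val_pow_eq_pow_val, Xu_val,
      AddMonoidAlgebra.single_pow, AddMonoidAlgebra.single_mul_single]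
    simp

lemma hasTop_adj (hD : Function.Injective D) (i : Fin n) : ∃ s : Bool,
    HasTop D (adjVar Q i) (exv Q s i - Finsupp.single i 1) ∧
    ∀ s', D (exv Q s' i - Finsupp.single i 1) ≤ D (exv Q s i - Finsupp.single i 1) := by
  classical
  cases hfi : Q.frozen i
  · have hadj : adjVar Q i = AddMonoidAlgebra.single (exv Q true i - Finsupp.single i 1) 1 +
        AddMonoidAlgebra.single (exv Q false i - Finsupp.single i 1) 1 := by
      have e1 : (Pp Q i : MvLaurent n) = AddMonoidAlgebra.single (exv Q true i) 1 := by
        rw [Pp, prod_single]; simp [exv, ex, hfi]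
      have e2 : (Pm Q i : MvLaurent n) = AddMonoidAlgebra.single (exv Q false i) 1 := by
        rw [Pm, prod_single]; simp [exv, ex, hfi]
      rw [adjVar, e1, e2, Xu_inv_val, mul_add, AddMonoidAlgebra.single_mul_single,
        AddMonoidAlgebra.single_mul_single]
      simp [hfi, sub_eq_neg_add]
    have gen : ∀ a b : Fin n →₀ ℤ, D a ≤ D b → HasTop D
        (AddMonoidAlgebra.single a (1 : ℤ) + AddMonoidAlgebra.single b 1) b := by
      intro a b hab
      constructor
      · simp only [AddMonoidAlgebra.coeff_add, AddMonoidAlgebra.coeff_single, Finsupp.add_apply,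
          Finsupp.single_apply]
        split_ifs <;> simp_all
      · intro e he hne
        by_cases hae : a = e
        · subst hae
          exact lt_of_le_of_ne hab (fun h => hne (hD h))
        · simp [Finsupp.single_apply, hae, hne.symm] at he
    rcases le_total (D (exv Q true i - Finsupp.single i 1)) (D (exv Q false i - Finsupp.single i 1))
      with h | h
    · refine ⟨false, by rw [hadj]; exact gen _ _ h, ?_⟩
      rintro (_ | _)
      · exact le_rfl
      · exact h
    · refine ⟨true, by rw [hadj, add_comm]; exact gen _ _ h, ?_⟩
      rintro (_ | _)
      · exact h
      · exact le_rfl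
  · have h0 : ∀ s, exv Q s i = 0 := fun s => by simp [exv, ex, hfi]
    refine ⟨true, ?_, fun s' => by rw [h0, h0]⟩
    rw [h0, zero_sub, adjVar, if_pos hfi, Xu_inv_val]
    exact hasTop_single _

lemma hasTop_monomial {T : Fin n ⊕ Fin n → Fin n →₀ ℤ}
    (hT : ∀ k, HasTop D (piHom Q (X k)) (T k)) (m : (Fin n ⊕ Fin n) →₀ ℕ) :
    HasTop D (piHom Q (monomial m 1)) (∑ k, m k • T k) := by
  have : (monomial m (1 : ℤ)) = ∏ k, X k ^ m k := by
    rw [monomial_eq, map_one, one_mul, Finsupp.prod_fintype _ _ (by simp)]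
  rw [this, map_prod]
  refine HasTop.prod _ fun k => ?_
  rw [map_pow]
  exact (hT k).pow _

lemma not_ker {T : Fin n ⊕ Fin n → Fin n →₀ ℤ}
    (hT : ∀ k, HasTop D (piHom Q (X k)) (T k)) (f : MvPolynomial (Fin n ⊕ Fin n) ℤ)
    (m : (Fin n ⊕ Fin n) →₀ ℕ) (hm : m ∈ f.support)
    (hmax : ∀ m' ∈ f.support, m' ≠ m → D (∑ k, m' k • T k) < D (∑ k, m k • T k)) :
    piHom Q f ≠ 0 := by
  intro h0
  have e : piHom Q f = ∑ m' ∈ f.support, (f.coeff m') • piHom Q (monomial m' 1) := by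
    conv_lhs => rw [f.as_sum]
    rw [map_sum]
    refine Finset.sum_congr rfl fun m' _ => ?_
    rw [← map_zsmul, smul_monomial, smul_eq_mul, mul_one]
  have h1 : (piHom Q f).coeff (∑ k, m k • T k) =
      f.coeff m * (piHom Q (monomial m 1)).coeff (∑ k, m k • T k) := by
    rw [e, AddMonoidAlgebra.coeff_sum, Finsupp.finsetSum_apply, Finset.sum_eq_single_of_mem m hm]
    · rw [AddMonoidAlgebra.coeff_smul, Finsupp.smul_apply, smul_eq_mul]
    · intro m' hm' hne
      have : (piHom Q (monomial m' 1)).coeff (∑ k, m k • T k) = 0 := by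
        by_contra hc
        exact absurd ((hasTop_monomial hT m').le hc) (not_le.2 (hmax m' hm' hne))
      rw [AddMonoidAlgebra.coeff_smul, Finsupp.smul_apply, this, smul_zero]
  rw [h0] at h1
  exact mul_ne_zero (mem_support_iff.1 hm) (hasTop_monomial hT m).1 (by rw [← h1]; simp)

end top

/-- weighted order tie-broken lexicographically -/
noncomputable def ww (w : Fin n → ℕ) : (Fin n →₀ ℤ) →+ ℤ where
  toFun v := -∑ i, (w i : ℤ) * v i
  map_zero' := by simp
  map_add' a b := by simp [mul_add, Finset.sum_add_distrib]; ring

noncomputable def DD (w : Fin n → ℕ) : (Fin n →₀ ℤ) →+ ℤ ×ₗ Lex (Fin n →₀ ℤ) where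
  toFun v := toLex (ww w v, toLex v)
  map_zero' := by simp
  map_add' a b := by rw [map_add]; rfl

lemma DD_inj (w : Fin n → ℕ) : Function.Injective (DD w) := by
  intro a b h
  have := congrArg (fun x => ofLex (ofLex x).2) h
  exact this

lemma DD_lt {w : Fin n → ℕ} {a b} (h : ww w a < ww w b) : DD w a < DD w b :=
  Prod.Lex.toLex_lt_toLex.2 (Or.inl h)

lemma DD_le {w : Fin n → ℕ} {a b} (h : DD w a ≤ DD w b) : ww w a ≤ ww w b := by
  by_contra hc
  exact absurd (DD_lt (not_le.1 hc)) (not_lt.2 h)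

lemma main_sub (f : MvPolynomial (Fin n ⊕ Fin n) ℤ) (hf : piHom Q f = 0)
    (m : (Fin n ⊕ Fin n) →₀ ℕ) (hm : m ∈ f.support) (hmax : ∀ m' ∈ f.support, ydeg m' ≤ ydeg m)
    (hxy : ∀ i, m (inl i) = 0 ∨ m (inr i) = 0) :
    ∃ T, IsVertexMinimalCycle Q T ∧ ∀ i ∈ T, m (inr i) ≠ 0 := by
  classical
  by_contra hno
  let B : Finset (Fin n) := Finset.univ.filter fun i => m (inr i) ≠ 0
  have hBmem : ∀ i, i ∈ B ↔ m (inr i) ≠ 0 := fun i => by simp [B]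
  have hac : ¬ ∃ a l, IsCycle Q a l ∧ ∀ u ∈ a :: l, u ∈ B := fun h => by
    obtain ⟨T, hT, hTB⟩ := exists_minimal B h
    exact hno ⟨T, hT, fun i hi => (hBmem i).1 (hTB hi)⟩
  obtain ⟨w, hw⟩ := exists_weight B hac
  choose s hs hs' using hasTop_adj (Q := Q) (DD_inj w)
  let T : Fin n ⊕ Fin n → Fin n →₀ ℤ :=
    Sum.elim (fun i => Finsupp.single i 1) fun i => exv Q (s i) i - Finsupp.single i 1
  have hT : ∀ k, HasTop (DD w) (piHom Q (X k)) (T k) := by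
    rintro (i | i)
    · rw [pi_inl, Xu_val]; exact hasTop_single _
    · rw [pi_inr]; exact hs i
  have hwe : ∀ (b : Bool) i, ww w (exv Q b i - Finsupp.single i 1) =
      (w i : ℤ) - ((∑ j, w j * ex Q b i j : ℕ) : ℤ) := by
    intro b i
    simp [ww, exv_apply, mul_sub, Finset.sum_sub_distrib, Finsupp.single_apply]
  have hsig : ∀ i b, ∑ j, w j * ex Q (s i) i j ≤ ∑ j, w j * ex Q b i j := by
    intro i b
    have := DD_le (hs' i b)
    rw [hwe, hwe] at this
    omega
  have hwB : ∀ i ∈ B, w i = 1 + ∑ j, w j * ex Q (s i) i j := by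
    intro i hi
    rw [hw i, if_pos hi]
    congr 1
    apply le_antisymm
    · cases s i
      · exact min_le_right _ _
      · exact min_le_left _ _
    · exact le_min (hsig i true) (hsig i false)
  have hwA : ∀ i ∉ B, w i = 0 := fun i hi => by rw [hw i, if_neg hi]
  have hl : ∀ i, ww w (T (inl i)) = -(w i : ℤ) := by
    intro i
    simp [T, ww, Finsupp.single_apply]
  have hr : ∀ i, ww w (T (inr i)) = (w i : ℤ) - ((∑ j, w j * ex Q (s i) i j : ℕ) : ℤ) :=
    fun i => hwe _ _
  have hrB : ∀ i ∈ B, ww w (T (inr i)) = 1 := by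
    intro i hi
    rw [hr]
    have := hwB i hi
    omega
  have hrA : ∀ i ∉ B, ww w (T (inr i)) ≤ 0 := by
    intro i hi
    rw [hr]
    have := hwA i hi
    omega
  have hphi : ∀ m' : (Fin n ⊕ Fin n) →₀ ℕ, ww w (∑ k, m' k • T k) = ydeg m' -
      (∑ i, ((m' (inl i) : ℤ) * w i + (m' (inr i) : ℤ) * (1 - ww w (T (inr i))))) := by
    intro m'
    rw [map_sum, Fintype.sum_sum_type, ydeg]
    simp only [map_nsmul, hl, nsmul_eq_mul]
    push_cast
    rw [← Finset.sum_add_distrib, ← Finset.sum_sub_distrib]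
    refine Finset.sum_congr rfl fun i _ => ?_
    ring
  have hterm1 : ∀ (m' : (Fin n ⊕ Fin n) →₀ ℕ) i, 0 ≤ (m' (inl i) : ℤ) * w i := by
    intro m' i; positivity
  have hterm2 : ∀ (m' : (Fin n ⊕ Fin n) →₀ ℕ) i,
      0 ≤ (m' (inr i) : ℤ) * (1 - ww w (T (inr i))) := by
    intro m' i
    refine mul_nonneg (by positivity) ?_
    by_cases hi : i ∈ B
    · rw [hrB i hi]; norm_num
    · have := hrA i hi; omega
  have hle : ∀ m' : (Fin n ⊕ Fin n) →₀ ℕ, ww w (∑ k, m' k • T k) ≤ ydeg m' := by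
    intro m'
    rw [hphi]
    have := Finset.sum_nonneg fun i (_ : i ∈ Finset.univ) => add_nonneg (hterm1 m' i) (hterm2 m' i)
    omega
  have heq : ww w (∑ k, m k • T k) = ydeg m := by
    rw [hphi, Finset.sum_eq_zero, sub_zero]
    intro i _
    by_cases hi : i ∈ B
    · have := (hBmem i).1 hi
      have h0 : m (inl i) = 0 := by
        rcases hxy i with h | h
        · exact h
        · exact (this h).elim
      rw [hrB i hi, h0]; simp
    · have h0 : m (inr i) = 0 := by
        by_contra h
        exact hi ((hBmem i).2 h)
      rw [hwA i hi, h0]; simp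
  have hsupp : ∀ m' ∈ f.support, ww w (∑ k, m' k • T k) = ydeg m →
      (∀ i ∈ B, m' (inl i) = 0) ∧ (∀ i ∉ B, m' (inr i) = 0) := by
    intro m' hm' he
    have h1 := hmax m' hm'
    rw [hphi] at he
    have h2 : ∑ i, ((m' (inl i) : ℤ) * w i + (m' (inr i) : ℤ) * (1 - ww w (T (inr i)))) = 0 := by
      have := Finset.sum_nonneg fun i (_ : i ∈ Finset.univ) =>
        add_nonneg (hterm1 m' i) (hterm2 m' i)
      omega
    rw [Finset.sum_eq_zero_iff_of_nonneg fun i _ => add_nonneg (hterm1 m' i) (hterm2 m' i)] at h2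
    constructor
    · intro i hi
      have h3 := h2 i (Finset.mem_univ i)
      have h4 : (m' (inl i) : ℤ) * w i = 0 := by
        have := hterm1 m' i; have := hterm2 m' i; omega
      rcases mul_eq_zero.1 h4 with h | h
      · exact_mod_cast h
      · have := hwB i hi; omega
    · intro i hi
      have h3 := h2 i (Finset.mem_univ i)
      have h4 : (m' (inr i) : ℤ) * (1 - ww w (T (inr i))) = 0 := by
        have := hterm1 m' i; have := hterm2 m' i; omega
      rcases mul_eq_zero.1 h4 with h | h
      · exact_mod_cast h
      · have := hrA i hi; omega
  obtain ⟨M, hM, hMmax⟩ := Finset.exists_max_image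
    (f.support.filter fun m' => ww w (∑ k, m' k • T k) = ydeg m)
    (fun m' => DD w (∑ k, m' k • T k)) ⟨m, Finset.mem_filter.2 ⟨hm, heq⟩⟩
  rw [Finset.mem_filter] at hM
  refine not_ker hT f M hM.1 ?_ hf
  intro m' hm' hne
  by_cases hd : ww w (∑ k, m' k • T k) = ydeg m
  · refine lt_of_le_of_ne (hMmax m' (Finset.mem_filter.2 ⟨hm', hd⟩)) fun h => hne ?_
    have hv := DD_inj w h
    obtain ⟨p1, p2⟩ := hsupp m' hm' hd
    obtain ⟨q1, q2⟩ := hsupp M hM.1 hM.2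
    have coord : ∀ (m' : (Fin n ⊕ Fin n) →₀ ℕ) i, (∑ k, m' k • T k) i =
        (m' (inl i) : ℤ) - m' (inr i) + ∑ j, (m' (inr j) : ℤ) * ex Q (s j) j i := by
      intro m' i
      rw [Fintype.sum_sum_type, Finsupp.add_apply, Finsupp.finsetSum_apply, Finsupp.finsetSum_apply]
      simp [T, exv_apply, mul_sub, Finset.sum_sub_distrib, Finsupp.single_apply]
      ring
    have hex : ∀ j ∈ B, ∀ i ∈ B, ex Q (s j) j i ≠ 0 → w i < w j := by
      intro j hj i hi hne
      have h1 := hwB j hj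
      have h2 : w i * ex Q (s j) j i ≤ ∑ k, w k * ex Q (s j) j k :=
        Finset.single_le_sum (f := fun k => w k * ex Q (s j) j k) (fun _ _ => Nat.zero_le _)
          (Finset.mem_univ i)
      have h3 := Nat.le_mul_of_pos_right (w i) (Nat.pos_of_ne_zero hne)
      omega
    have hyy : ∀ j, m' (inr j) = M (inr j) := by
      by_contra hc
      push Not at hc
      obtain ⟨j0, hj0⟩ := hc
      obtain ⟨i, hi, himax⟩ := Finset.exists_max_image
        (Finset.univ.filter fun j => m' (inr j) ≠ M (inr j)) w ⟨j0, by simpa using hj0⟩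
      have hi' : m' (inr i) ≠ M (inr i) := by simpa using hi
      have hiB : i ∈ B := by
        by_contra hiB
        exact hi' (by rw [p2 i hiB, q2 i hiB])
      have hci := DFunLike.congr_fun hv i
      rw [coord, coord, p1 i hiB, q1 i hiB] at hci
      have : ∑ j, (m' (inr j) : ℤ) * ex Q (s j) j i = ∑ j, (M (inr j) : ℤ) * ex Q (s j) j i := by
        refine Finset.sum_congr rfl fun j _ => ?_
        by_cases hjj : m' (inr j) = M (inr j)
        · rw [hjj]
        · have hjB : j ∈ B := by
            by_contra hjB
            exact hjj (by rw [p2 j hjB, q2 j hjB])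
          have hz : ex Q (s j) j i = 0 := by
            by_contra hz
            have h1 := hex j hjB i hiB hz
            have h2 := himax j (by simpa using hjj)
            omega
          rw [hz]; simp
      rw [this] at hci
      apply hi'
      omega
    ext k
    rcases k with i | i
    · have hci := DFunLike.congr_fun hv i
      rw [coord, coord] at hci
      simp only [hyy] at hci
      omega
    · exact hyy i
  · apply DD_lt
    rw [hM.2]
    refine lt_of_le_of_ne ((hle m').trans ?_) hd
    exact_mod_cast hmax m' hm'

lemma mem_of_dvd {I : Ideal (MvPolynomial (Fin n ⊕ Fin n) ℤ)} {a m : (Fin n ⊕ Fin n) →₀ ℕ}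
    (h : monomial a (1 : ℤ) ∈ I) (hle : a ≤ m) : monomial m (1 : ℤ) ∈ I := by
  have : monomial m (1 : ℤ) = monomial (m - a) 1 * monomial a 1 := by
    rw [monomial_mul, tsub_add_cancel_of_le hle, one_mul]
  rw [this]
  exact I.mul_mem_left _ h

end LB

open MvPolynomial in
/-- For any monomial order on `ℤ[x₁,...,xₙ,y₁,...,yₙ]` in which the `y`-variables are
much more expensive than the `x`-variables, the initial ideal of the kernel `K_Q` of
`π` is the squarefree monomial ideal generated by the `xᵢyᵢ` together with the
monomials `y_{v₁}⋯y_{v_k}` over vertex-minimal directed cycles of unfrozen vertices. -/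
theorem initial_ideal_of_lower_bound_ideal {n : ℕ} (Q : IceQuiver n)
    (lt : ((Fin n ⊕ Fin n) →₀ ℕ) → ((Fin n ⊕ Fin n) →₀ ℕ) → Prop)
    (hirr : ∀ a, ¬lt a a)
    (htrans : ∀ a b c, lt a b → lt b c → lt a c)
    (htotal : ∀ a b, a ≠ b → lt a b ∨ lt b a)
    (hadd : ∀ a b c, lt a b → lt (a + c) (b + c))
    (hzero : ∀ a, a ≠ 0 → lt 0 a)
    (hwf : WellFounded lt)
    (hy : ∀ a b, ydeg a < ydeg b → lt a b) :
    initialIdeal lt (RingHom.ker (piHom Q)) =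
      Ideal.span
        ({g | ∃ i : Fin n, g = X (inl i) * X (inr i)} ∪
          {g | ∃ T : Finset (Fin n), IsVertexMinimalCycle Q T ∧
            g = ∏ i ∈ T, X (inr i)}) := by
  classical
  apply le_antisymm
  · rw [initialIdeal, Ideal.span_le]
    rintro g ⟨f, hf, m, hm, hlt, rfl⟩
    rw [RingHom.mem_ker] at hf
    have hmax : ∀ m' ∈ f.support, ydeg m' ≤ ydeg m := by
      intro m' hm'
      by_contra hc
      have h1 := hy _ _ (not_le.1 hc)
      by_cases he : m' = m
      · rw [he] at hc; exact hc le_rfl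
      · exact hirr _ (htrans _ _ _ h1 (hlt m' hm' he))
    by_cases hxy : ∀ i, m (inl i) = 0 ∨ m (inr i) = 0
    · obtain ⟨T, hT, hTm⟩ := LB.main_sub f hf m hm hmax hxy
      have e : (∏ i ∈ T, X (inr i) : MvPolynomial (Fin n ⊕ Fin n) ℤ) =
        monomial (∑ i ∈ T, Finsupp.single (inr i) 1) 1 := by
        rw [monomial_sum_one]; rfl
      refine LB.mem_of_dvd (a := ∑ i ∈ T, Finsupp.single (inr i) 1) ?_ ?_
      · rw [← e]
        exact Ideal.subset_span (Or.inr ⟨T, hT, rfl⟩)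
      · intro k
        rw [Finsupp.finsetSum_apply]
        rcases k with i | i
        · simp
        · simp only [Finsupp.single_apply, Sum.inr.injEq, Finset.sum_ite_eq']
          split_ifs with hi
          · exact Nat.one_le_iff_ne_zero.2 (hTm i hi)
          · exact Nat.zero_le _
    · push Not at hxy
      obtain ⟨i, h1, h2⟩ := hxy
      refine LB.mem_of_dvd (a := Finsupp.single (inl i) 1 + Finsupp.single (inr i) 1) ?_ ?_
      · have e : (X (inl i) * X (inr i) : MvPolynomial (Fin n ⊕ Fin n) ℤ) =
          monomial (Finsupp.single (inl i) 1 + Finsupp.single (inr i) 1) 1 := by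
          simp [X, monomial_mul]
        rw [← e]
        exact Ideal.subset_span (Or.inl ⟨i, rfl⟩)
      · intro k
        rw [Finsupp.add_apply]
        rcases k with j | j
        · by_cases hj : i = j
          · subst hj
            simpa using Nat.one_le_iff_ne_zero.2 h1
          · simp [hj]
        · by_cases hj : i = j
          · subst hj
            simpa using Nat.one_le_iff_ne_zero.2 h2
          · simp [hj]
  · exact LB.supset lt hy
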